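/- arXiv:1905.01701 — 4 statements merged into one kernel-verified Lean document; each statement's English description precedes it below -/
import Mathlib

section
/- Let μ, λ be real numbers with μ ≠ λ, and let a₁, a₂, b₁, b₂ be real constants with a₁² + a₂² = 1 and b₁² + b₂² = 1. Suppose φ, ψ : [0,1] → ℝ are twice continuously differentiable and satisfy, for all x ∈ [0,1], (p(x)φ′(x))′ − q(x)φ(x) = −μ r(x) φ(x) and (p(x)ψ′(x))′ − q(x)ψ(x) = −λ r(x) ψ(x), together with the boundary conditions b₁φ(0) + b₂φ′(0) = 0, a₁φ(1) + a₂φ′(1) = 1, b₁ψ(0) + b₂ψ′(0) = 0 and a₁ψ(1) + a₂ψ′(1) = 0. If ψ is not identically zero on [0,1], then ∫₀¹ r(x) φ(x) ψ(x) dx ≠ 0. -/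
open Set

/-- A solution on `[a, b]` of the planar linear system `y' = α z`, `z' = β y` with continuous
coefficients that vanishes at `b` vanishes identically. -/
theorem eq_zero_of_linear_system_of_eq_zero_right {a b : ℝ} {α β y z : ℝ → ℝ}
    (hα : ContinuousOn α (Icc a b)) (hβ : ContinuousOn β (Icc a b))
    (hy : ∀ t ∈ Icc a b, HasDerivWithinAt y (α t * z t) (Icc a b) t)
    (hz : ∀ t ∈ Icc a b, HasDerivWithinAt z (β t * y t) (Icc a b) t)
    (hyb : y b = 0) (hzb : z b = 0) :
    ∀ t ∈ Icc a b, y t = 0 := by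
  obtain ⟨A, hA⟩ := isCompact_Icc.exists_bound_of_continuousOn hα
  obtain ⟨B, hB⟩ := isCompact_Icc.exists_bound_of_continuousOn hβ
  have hlip : ∀ t ∈ Ioc a b, LipschitzOnWith (max A B).toNNReal
      (fun w : ℝ × ℝ => (α t * w.2, β t * w.1)) univ := by
    intro t ht
    have ht' := Ioc_subset_Icc_self ht
    have hK : max A B ≤ (max A B).toNNReal := Real.le_coe_toNNReal _
    refine (LipschitzWith.of_dist_le_mul fun v w => ?_).lipschitzOnWith
    simp only [Prod.dist_eq, Real.dist_eq, ← mul_sub, abs_mul]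
    refine max_le ?_ ?_
    · exact mul_le_mul (((hA t ht').trans (le_max_left _ _)).trans hK) (le_max_right _ _)
        (abs_nonneg _) (NNReal.coe_nonneg _)
    · exact mul_le_mul (((hB t ht').trans (le_max_right _ _)).trans hK) (le_max_left _ _)
        (abs_nonneg _) (NNReal.coe_nonneg _)
  have hd : ∀ t ∈ Icc a b, HasDerivWithinAt (fun s => (y s, z s)) (α t * z t, β t * y t)
      (Icc a b) t := fun t ht => (hy t ht).prodMk (hz t ht)
  have heq : EqOn (fun s => (y s, z s)) (fun _ => (0, 0)) (Icc a b) := by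
    refine ODE_solution_unique_of_mem_Icc_left
      (v := fun t (w : ℝ × ℝ) => (α t * w.2, β t * w.1)) (s := fun _ => univ) hlip
      (fun t ht => (hd t ht).continuousWithinAt) (fun t ht => ?_) (fun _ _ => mem_univ _)
      continuousOn_const (fun t _ => ?_) (fun _ _ => mem_univ _) (by simp [hyb, hzb])
    · exact (hd t (Ioc_subset_Icc_self ht)).mono_of_mem_nhdsWithin (Icc_mem_nhdsLE_of_mem ht)
    · exact (hasDerivWithinAt_const t (Iic t) ((0, 0) : ℝ × ℝ)).congr_deriv
        (Prod.ext (mul_zero _).symm (mul_zero _).symm)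
  exact fun t ht => congrArg Prod.fst (heq ht)

/-- Two vectors annihilated by the same nonzero linear form on the plane are proportional. -/
theorem mul_sub_mul_eq_zero_of_linear_form {b₁ b₂ u u' v v' : ℝ} (hb : b₁ ^ 2 + b₂ ^ 2 = 1)
    (hu : b₁ * u + b₂ * u' = 0) (hv : b₁ * v + b₂ * v' = 0) : u' * v - u * v' = 0 := by
  linear_combination (-(u' * v - u * v')) * hb + (b₂ * v - b₁ * v') * hu - (b₂ * u - b₁ * u') * hv

/-- For a `C²` function `φ`, the flux `p φ'` has a derivative on `[a, b]`. -/
theorem hasDerivWithinAt_flux {a b : ℝ} (hab : a < b) {p φ : ℝ → ℝ}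
    (hp : ContDiffOn ℝ 1 p (Icc a b)) (hφ : ContDiffOn ℝ 2 φ (Icc a b)) {x : ℝ}
    (hx : x ∈ Icc a b) :
    HasDerivWithinAt (fun t => p t * derivWithin φ (Icc a b) t)
      (derivWithin (fun t => p t * derivWithin φ (Icc a b) t) (Icc a b) x) (Icc a b) x :=
  ((hp.mul (hφ.derivWithin (uniqueDiffOn_Icc hab) (by norm_num))).differentiableOn
    one_ne_zero x hx).hasDerivWithinAt

theorem stmt_3
    (p q r φ ψ : ℝ → ℝ) (μ lam : ℝ) (hne : μ ≠ lam)
    (a₁ a₂ b₁ b₂ : ℝ) (ha : a₁ ^ 2 + a₂ ^ 2 = 1) (hb : b₁ ^ 2 + b₂ ^ 2 = 1)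
    (hp : ContDiffOn ℝ 1 p (Set.Icc 0 1))
    (hppos : ∀ x ∈ Set.Icc (0:ℝ) 1, 0 < p x)
    (hq : ContinuousOn q (Set.Icc 0 1))
    (hr : ContinuousOn r (Set.Icc 0 1))
    (hrpos : ∀ x ∈ Set.Icc (0:ℝ) 1, 0 < r x)
    (hφ : ContDiffOn ℝ 2 φ (Set.Icc 0 1))
    (hψ : ContDiffOn ℝ 2 ψ (Set.Icc 0 1))
    (hodeφ : ∀ x ∈ Set.Icc (0:ℝ) 1,
      derivWithin (fun t => p t * derivWithin φ (Set.Icc 0 1) t) (Set.Icc 0 1) x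
        - q x * φ x = -μ * (r x * φ x))
    (hodeψ : ∀ x ∈ Set.Icc (0:ℝ) 1,
      derivWithin (fun t => p t * derivWithin ψ (Set.Icc 0 1) t) (Set.Icc 0 1) x
        - q x * ψ x = -lam * (r x * ψ x))
    (hbcφ0 : b₁ * φ 0 + b₂ * derivWithin φ (Set.Icc 0 1) 0 = 0)
    (hbcφ1 : a₁ * φ 1 + a₂ * derivWithin φ (Set.Icc 0 1) 1 = 1)
    (hbcψ0 : b₁ * ψ 0 + b₂ * derivWithin ψ (Set.Icc 0 1) 0 = 0)
    (hbcψ1 : a₁ * ψ 1 + a₂ * derivWithin ψ (Set.Icc 0 1) 1 = 0)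
    (hnz : ∃ x ∈ Set.Icc (0:ℝ) 1, ψ x ≠ 0) :
    (∫ x in (0:ℝ)..1, r x * φ x * ψ x) ≠ 0 := by
  intro hint
  have hφd : ∀ x ∈ Icc (0:ℝ) 1, HasDerivWithinAt φ (derivWithin φ (Icc 0 1) x) (Icc 0 1) x :=
    fun x hx => (hφ.differentiableOn two_ne_zero x hx).hasDerivWithinAt
  have hψd : ∀ x ∈ Icc (0:ℝ) 1, HasDerivWithinAt ψ (derivWithin ψ (Icc 0 1) x) (Icc 0 1) x :=
    fun x hx => (hψ.differentiableOn two_ne_zero x hx).hasDerivWithinAt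
  have hWd : ∀ x ∈ Icc (0:ℝ) 1, HasDerivWithinAt
      (fun t => p t * derivWithin φ (Icc 0 1) t * ψ t - φ t * (p t * derivWithin ψ (Icc 0 1) t))
      ((lam - μ) * (r x * φ x * ψ x)) (Icc 0 1) x := by
    intro x hx
    refine (((hasDerivWithinAt_flux one_pos hp hφ hx).mul (hψd x hx)).sub
      ((hφd x hx).mul (hasDerivWithinAt_flux one_pos hp hψ hx))).congr_deriv ?_
    linear_combination ψ x * hodeφ x hx - φ x * hodeψ x hx
  have hcont : ContinuousOn (fun x => (lam - μ) * (r x * φ x * ψ x)) (Icc 0 1) :=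
    continuousOn_const.mul ((hr.mul hφ.continuousOn).mul hψ.continuousOn)
  have hgreen := intervalIntegral.integral_eq_sub_of_hasDerivAt_of_le zero_le_one
    (fun x hx => (hWd x hx).continuousWithinAt)
    (fun x hx => (hWd x (Ioo_subset_Icc_self hx)).hasDerivAt (Icc_mem_nhds hx.1 hx.2))
    (hcont.intervalIntegrable_of_Icc zero_le_one)
  rw [intervalIntegral.integral_const_mul, hint] at hgreen
  have h0 := mul_sub_mul_eq_zero_of_linear_form hb hbcφ0 hbcψ0
  have h1 : derivWithin φ (Icc 0 1) 1 * ψ 1 - φ 1 * derivWithin ψ (Icc 0 1) 1 = 0 := by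
    refine (mul_eq_zero.1 ?_).resolve_left (hppos 1 (right_mem_Icc.2 zero_le_one)).ne'
    linear_combination p 0 * h0 - hgreen
  have hψ1 : ψ 1 = 0 := by
    linear_combination (-ψ 1) * hbcφ1 + φ 1 * hbcψ1 + a₂ * h1
  have hψ1' : derivWithin ψ (Icc 0 1) 1 = 0 := by
    linear_combination (-derivWithin ψ (Icc 0 1) 1) * hbcφ1
      + derivWithin φ (Icc 0 1) 1 * hbcψ1 - a₁ * h1
  obtain ⟨x, hx, hxne⟩ := hnz
  refine hxne (eq_zero_of_linear_system_of_eq_zero_right (α := fun t => (p t)⁻¹)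
    (β := fun t => q t - lam * r t) (z := fun t => p t * derivWithin ψ (Icc 0 1) t)
    (hp.continuousOn.inv₀ fun t ht => (hppos t ht).ne') (hq.sub (continuousOn_const.mul hr))
    (fun t ht => ?_) (fun t ht => ?_) hψ1 (by simp [hψ1']) x hx)
  · exact (hψd t ht).congr_deriv (inv_mul_cancel_left₀ (hppos t ht).ne' _).symm
  · refine (hasDerivWithinAt_flux one_pos hp hψ ht).congr_deriv ?_
    linear_combination hodeψ t ht
end

section
/- Let N ≥ 1 be an integer, let λ₁ < λ₂ < ⋯ < λ_N be real numbers, set C := diag(−λ₁,…,−λ_N) ∈ ℝ^{N×N}, and let b ∈ ℝ^N with b_n ≠ 0 for every n ∈ {1,…,N}. Then there exist a vector K ∈ ℝ^N, a constant σ > 0, and a symmetric positive definite matrix R ∈ ℝ^{N×N} such that R(C + bKᵀ) + (C + bKᵀ)ᵀR ≤ −2σI in the sense of quadratic forms, i.e., zᵀ(R(C + bKᵀ) + (C + bKᵀ)ᵀR)z ≤ −2σ|z|² for all z ∈ ℝ^N. -/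
open scoped Matrix

/-- A real positive definite matrix is coercive with respect to the Euclidean norm. -/
theorem Matrix.PosDef.exists_pos_mul_sum_sq_le {n : Type*} [Fintype n] {A : Matrix n n ℝ}
    (hA : A.PosDef) : ∃ c : ℝ, 0 < c ∧ ∀ z : n → ℝ, c * ∑ i, z i ^ 2 ≤ z ⬝ᵥ (A *ᵥ z) := by
  have hcont : Continuous fun z : n → ℝ => z ⬝ᵥ (A *ᵥ z) := by fun_prop
  obtain ⟨m, hm, hmin⟩ := (isCompact_sphere (0 : n → ℝ) 1).exists_forall_le' hcont.continuousOn
    (a := 0) fun z hz => by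
      have hz0 : z ≠ 0 := by
        rintro rfl
        simp at hz
      simpa using hA.dotProduct_mulVec_pos hz0
  refine ⟨m / (Fintype.card n + 1), by positivity, fun z => ?_⟩
  rcases eq_or_ne z 0 with rfl | hz
  · simp
  have hnorm : 0 < ‖z‖ := norm_pos_iff.mpr hz
  have hunit : m ≤ (‖z‖⁻¹ • z) ⬝ᵥ (A *ᵥ (‖z‖⁻¹ • z)) :=
    hmin _ (by simp [norm_smul, hnorm.ne'])
  rw [Matrix.mulVec_smul, smul_dotProduct, dotProduct_smul, smul_eq_mul, smul_eq_mul,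
    ← mul_assoc, ← mul_inv, inv_mul_eq_div, le_div_iff₀ (by positivity)] at hunit
  have hsum : ∑ i, z i ^ 2 ≤ (Fintype.card n + 1) * (‖z‖ * ‖z‖) := by
    calc ∑ i, z i ^ 2 ≤ ∑ _i : n, ‖z‖ * ‖z‖ := by
          refine Finset.sum_le_sum fun i _ => ?_
          rw [← sq, sq_le_sq, abs_norm]
          exact norm_le_pi_norm z i
      _ ≤ _ := by
          rw [Finset.sum_const, Finset.card_univ, nsmul_eq_mul]
          gcongr
          linarith
  calc m / (Fintype.card n + 1) * ∑ i, z i ^ 2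
      ≤ m / (Fintype.card n + 1) * ((Fintype.card n + 1) * (‖z‖ * ‖z‖)) := by gcongr
    _ = m * (‖z‖ * ‖z‖) := by field_simp
    _ ≤ _ := hunit

/-- Strict positivity of the Szegő kernel `1 / (1 - q q')` on distinct points of `(-1, 1)`. -/
theorem sum_mul_div_one_sub_mul_pos {N : ℕ} {q y : Fin N → ℝ} (hq : ∀ n, |q n| < 1)
    (hinj : Function.Injective q) (hy : y ≠ 0) :
    0 < ∑ n, ∑ m, y n * y m / (1 - q n * q m) := by
  have hsum : HasSum (fun k : ℕ => (∑ n, y n * q n ^ k) ^ 2)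
      (∑ n, ∑ m, y n * y m / (1 - q n * q m)) := by
    have hterm : ∀ n m, HasSum (fun k : ℕ => y n * y m * (q n * q m) ^ k)
        (y n * y m / (1 - q n * q m)) := fun n m => by
      rw [div_eq_mul_inv]
      refine (hasSum_geometric_of_abs_lt_one ?_).mul_left _
      rw [abs_mul]
      exact mul_lt_one_of_nonneg_of_lt_one_left (abs_nonneg _) (hq n) (hq m).le
    convert hasSum_sum fun n (_ : n ∈ Finset.univ) =>
      hasSum_sum fun m (_ : m ∈ Finset.univ) => hterm n m using 2 with k
    rw [sq, Finset.sum_mul_sum]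
    refine Finset.sum_congr rfl fun n _ => Finset.sum_congr rfl fun m _ => ?_
    ring
  refine (hsum.nonneg fun k => sq_nonneg _).lt_of_ne fun h0 => hy ?_
  rw [← h0, hasSum_zero_iff_of_nonneg fun k => sq_nonneg _] at hsum
  exact Matrix.eq_zero_of_forall_pow_sum_mul_pow_eq_zero hinj fun i =>
    pow_eq_zero_iff two_ne_zero |>.mp (congrFun hsum (i : ℕ))

/-- A row- and column-scaled Cauchy matrix with distinct positive nodes is positive definite. -/
theorem Matrix.posDef_of_mul_div_add {N : ℕ} {d b : Fin N → ℝ} (hd : ∀ n, 0 < d n)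
    (hinj : Function.Injective d) (hb : ∀ n, b n ≠ 0) :
    (Matrix.of fun n m => 2 * b n * b m / (d n + d m)).PosDef := by
  refine .of_dotProduct_mulVec_pos ?_ fun z hz => ?_
  · ext n m
    simp only [Matrix.conjTranspose_apply, Matrix.of_apply, star_trivial]
    ring
  have hd1 : ∀ n, 0 < 1 + d n := fun n => by linarith [hd n]
  have hpos := sum_mul_div_one_sub_mul_pos (q := fun n => (1 - d n) / (1 + d n))
    (y := fun n => z n * b n / (1 + d n))
    (fun n => by
      rw [abs_lt, lt_div_iff₀ (hd1 n), div_lt_iff₀ (hd1 n)]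
      constructor <;> linarith [hd n])
    (fun n m h => hinj (by
      have := (div_eq_div_iff (hd1 n).ne' (hd1 m).ne').mp h
      linarith))
    (fun h => hz (funext fun n => by
      simpa [hb n, (hd1 n).ne'] using congrFun h n))
  have hform : star z ⬝ᵥ ((Matrix.of fun n m => 2 * b n * b m / (d n + d m)) *ᵥ z) =
      4 * ∑ n, ∑ m, (z n * b n / (1 + d n)) * (z m * b m / (1 + d m)) /
        (1 - (1 - d n) / (1 + d n) * ((1 - d m) / (1 + d m))) := by
    simp only [dotProduct, Matrix.mulVec, Matrix.of_apply, star_trivial, Finset.mul_sum]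
    refine Finset.sum_congr rfl fun n _ => Finset.sum_congr rfl fun m _ => ?_
    have h1 := (hd1 n).ne'
    have h2 := (hd1 m).ne'
    have h3 : d n + d m ≠ 0 := (add_pos (hd n) (hd m)).ne'
    have h4 : 1 - (1 - d n) / (1 + d n) * ((1 - d m) / (1 + d m)) =
        2 * (d n + d m) / ((1 + d n) * (1 + d m)) := by
      field_simp
      ring
    rw [h4]
    field_simp
    ring
  rw [hform]
  positivity

/- STATEMENT 6: existence of a stabilizing gain K, σ > 0 and symmetric positive
definite R with R(C + bKᵀ) + (C + bKᵀ)ᵀR ≤ -2σI in the quadratic form sense. -/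

theorem stmt_6 (N : ℕ) (hN : 1 ≤ N) (lam b : Fin N → ℝ)
    (hlam : StrictMono lam) (hb : ∀ n, b n ≠ 0) :
    ∃ (K : Fin N → ℝ) (σ : ℝ) (R : Matrix (Fin N) (Fin N) ℝ),
      0 < σ ∧ R.IsSymm ∧ R.PosDef ∧
      ∀ z : Fin N → ℝ,
        z ⬝ᵥ ((R * (Matrix.diagonal (fun n => -lam n) + Matrix.vecMulVec b K)
            + (Matrix.diagonal (fun n => -lam n) + Matrix.vecMulVec b K)ᵀ * R) *ᵥ z)
          ≤ -2 * σ * ∑ n, z n ^ 2 := by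
  obtain ⟨β, hβ, hd⟩ : ∃ β : ℝ, 0 < β ∧ ∀ n, 0 < β - lam n := by
    refine ⟨1 + ∑ n, |lam n|, by positivity, fun n => ?_⟩
    have := Finset.single_le_sum (f := fun n => |lam n|) (fun i _ => abs_nonneg _)
      (Finset.mem_univ n)
    linarith [le_abs_self (lam n)]
  set W : Matrix (Fin N) (Fin N) ℝ :=
    Matrix.of fun n m => 2 * b n * b m / ((β - lam n) + (β - lam m)) with hWdef
  have hW : W.PosDef := Matrix.posDef_of_mul_div_add hd
    (fun n m h => hlam.injective (sub_right_injective h)) hb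
  have hdet : IsUnit W.det := hW.det_pos.ne'.isUnit
  have hRsymm : (W⁻¹)ᵀ = W⁻¹ := by
    simpa [Matrix.conjTranspose_eq_transpose_of_trivial] using hW.inv.isHermitian.eq
  obtain ⟨c, hc, hcoer⟩ := hW.inv.exists_pos_mul_sum_sq_le
  -- Bass's identity: the Gramian `W` solves a shifted Lyapunov equation.
  have hlyap : Matrix.diagonal (fun n => -lam n) * W + W * Matrix.diagonal (fun n => -lam n)
      - (2 : ℝ) • Matrix.vecMulVec b b = (-2 * β) • W := by
    ext n m
    have h : (β - lam n) + (β - lam m) ≠ 0 := (add_pos (hd n) (hd m)).ne'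
    simp only [hWdef, Matrix.sub_apply, Matrix.add_apply, Matrix.diagonal_mul,
      Matrix.mul_diagonal, Matrix.smul_apply, Matrix.vecMulVec_apply, Matrix.of_apply,
      smul_eq_mul]
    field_simp
    ring
  have hclosed : W⁻¹ * (Matrix.diagonal (fun n => -lam n) + Matrix.vecMulVec b (-(W⁻¹ *ᵥ b)))
      + (Matrix.diagonal (fun n => -lam n) + Matrix.vecMulVec b (-(W⁻¹ *ᵥ b)))ᵀ * W⁻¹
      = (-2 * β) • W⁻¹ := by
    have hgain : Matrix.vecMulVec b (-(W⁻¹ *ᵥ b)) = -(Matrix.vecMulVec b b * W⁻¹) := by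
      rw [Matrix.vecMulVec_mul, Matrix.vecMulVec_neg, ← Matrix.mulVec_transpose, hRsymm]
    have hconj := congrArg (fun M => W⁻¹ * M * W⁻¹) hlyap
    have hWR : W * W⁻¹ = 1 := Matrix.mul_nonsing_inv W hdet
    have hRW : W⁻¹ * W = 1 := Matrix.nonsing_inv_mul W hdet
    simp only [Matrix.mul_sub, Matrix.sub_mul, Matrix.mul_add, Matrix.add_mul, Matrix.mul_smul,
      Matrix.smul_mul, hRW, Matrix.one_mul] at hconj
    rw [Matrix.mul_assoc W⁻¹ _ W⁻¹, Matrix.mul_assoc _ W W⁻¹, hWR, Matrix.mul_one,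
      ← Matrix.mul_assoc W⁻¹ W, hRW, Matrix.one_mul] at hconj
    rw [hgain, ← hconj, Matrix.transpose_add, Matrix.diagonal_transpose, Matrix.transpose_neg,
      Matrix.transpose_mul, Matrix.transpose_vecMulVec, hRsymm, two_smul]
    noncomm_ring
  refine ⟨-(W⁻¹ *ᵥ b), β * c, W⁻¹, mul_pos hβ hc, hRsymm, hW.inv, fun z => ?_⟩
  rw [hclosed, Matrix.smul_mulVec, dotProduct_smul, smul_eq_mul]
  nlinarith [mul_le_mul_of_nonneg_left (hcoer z) hβ.le]
end

section
/- Let N ≥ 1 be an integer and let ā > 0, b̄ > 0, L̄ ≥ 0 be real numbers. Then there exists κ > 0 such that L̄²(1 + 1/κ) < ā and L̄²(1 + κN) < b̄ if and only if L̄² < 2āb̄ / (ā + b̄ + √((ā − b̄)² + 4Nāb̄)). -/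
/-- The bound `2ab / (a + b + √((a - b)² + 4nab))` is the positive root of the quadratic
`n x² = (a - x) (b - x)`. -/
theorem lt_positive_root_iff {n a b x : ℝ} (hn : 1 ≤ n) (ha : 0 < a) (hb : 0 < b)
    (hx : 0 ≤ x) :
    x < 2 * a * b / (a + b + Real.sqrt ((a - b) ^ 2 + 4 * n * a * b)) ↔
      x < a ∧ x < b ∧ n * x ^ 2 < (a - x) * (b - x) := by
  have hab : 0 < a * b := mul_pos ha hb
  have hnab : a * b ≤ n * (a * b) := le_mul_of_one_le_left hab.le hn
  have hS : Real.sqrt ((a - b) ^ 2 + 4 * n * a * b) ^ 2 = (a - b) ^ 2 + 4 * n * a * b :=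
    Real.sq_sqrt (by nlinarith [sq_nonneg (a - b)])
  have hS_ge : a + b ≤ Real.sqrt ((a - b) ^ 2 + 4 * n * a * b) :=
    Real.le_sqrt_of_sq_le (by nlinarith)
  set S := Real.sqrt ((a - b) ^ 2 + 4 * n * a * b)
  have key : (2 * a * b - x * (a + b)) ^ 2 - (x * S) ^ 2
      = 4 * (a * b) * ((a - x) * (b - x) - n * x ^ 2) := by
    rw [mul_pow, hS]; ring
  rw [lt_div_iff₀ (by linarith)]
  constructor
  · intro h
    have hxS : 0 ≤ x * S := mul_nonneg hx (by linarith)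
    have h_lin : x * (a + b) < a * b := by
      linarith [mul_le_mul_of_nonneg_left hS_ge hx]
    have hxa := mul_nonneg hx ha.le
    have hxb := mul_nonneg hx hb.le
    refine ⟨lt_of_mul_lt_mul_right (by linarith : x * b < a * b) hb.le,
      lt_of_mul_lt_mul_right (by linarith : x * a < b * a) ha.le, ?_⟩
    have hsq : (x * S) ^ 2 < (2 * a * b - x * (a + b)) ^ 2 :=
      pow_lt_pow_left₀ (by linarith) hxS two_ne_zero
    have hpos : 0 < 4 * (a * b) * ((a - x) * (b - x) - n * x ^ 2) := by linarith
    linarith [pos_of_mul_pos_right hpos (by positivity)]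
  · rintro ⟨hxa, hxb, h⟩
    have hpos : 0 < 4 * (a * b) * ((a - x) * (b - x) - n * x ^ 2) :=
      mul_pos (by positivity) (by linarith)
    have hlt : x * S < 2 * a * b - x * (a + b) :=
      lt_of_pow_lt_pow_left₀ 2
        (by linarith [mul_lt_mul_of_pos_right hxa hb, mul_lt_mul_of_pos_right hxb ha])
        (by linarith)
    linarith

theorem exists_pos_mul_lt_iff {n a b x : ℝ} (hn : 0 < n) (ha : 0 < a) (hb : 0 < b)
    (hx : 0 ≤ x) :
    (∃ κ : ℝ, 0 < κ ∧ x * (1 + 1 / κ) < a ∧ x * (1 + κ * n) < b) ↔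
      x < a ∧ x < b ∧ n * x ^ 2 < (a - x) * (b - x) := by
  constructor
  · rintro ⟨κ, hκ, h₁, h₂⟩
    have hxκ : 0 ≤ x * (1 / κ) := by positivity
    have hxn : 0 ≤ x * (κ * n) := by positivity
    refine ⟨by linarith, by linarith, ?_⟩
    calc n * x ^ 2 = x * (1 / κ) * (x * (κ * n)) := by field_simp
      _ < (a - x) * (b - x) := mul_lt_mul'' (by linarith) (by linarith) hxκ hxn
  · rintro ⟨hxa, hxb, h⟩
    rcases hx.eq_or_lt with rfl | hx
    · exact ⟨1, one_pos, by simpa using ha, by simpa using hb⟩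
    have hax : 0 < a - x := sub_pos.2 hxa
    have hlt : x / (a - x) < (b - x) / (x * n) := by
      rw [div_lt_div_iff₀ hax (by positivity)]
      linarith
    obtain ⟨κ, h₁, h₂⟩ := exists_between hlt
    have hκ : 0 < κ := (div_pos hx hax).trans h₁
    rw [div_lt_iff₀ hax] at h₁
    rw [lt_div_iff₀ (by positivity)] at h₂
    refine ⟨κ, hκ, ?_, by linarith⟩
    have : x / κ < a - x := by
      rw [div_lt_iff₀ hκ]
      linarith
    rw [mul_add, mul_one_div]
    linarith

theorem stmt_7 (N : ℕ) (hN : 1 ≤ N) (a b L : ℝ)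
    (ha : 0 < a) (hb : 0 < b) (hL : 0 ≤ L) :
    (∃ κ : ℝ, 0 < κ ∧ L ^ 2 * (1 + 1 / κ) < a ∧ L ^ 2 * (1 + κ * N) < b) ↔
      L ^ 2 < 2 * a * b / (a + b + Real.sqrt ((a - b) ^ 2 + 4 * N * a * b)) := by
  have hn : (1 : ℝ) ≤ N := by exact_mod_cast hN
  rw [exists_pos_mul_lt_iff (by linarith) ha hb (sq_nonneg L),
    lt_positive_root_iff hn ha hb (sq_nonneg L)]
end

section
/- (Theorem 3.1, dissipation inequality for the nonlinear controller, spectral form.) Fix σ > 0 and, for (w, y) ∈ D × ℝ^N, set u := w + Σ_{i=1}^N y_i χ_i and define the controller v_i(w, y) := Σ_{m=1}^N g_{i,m}(σ − λ_m)⟨φ_m, w⟩ + Σ_{m=1}^N g_{i,m}⟨φ_m, F(u)⟩ for i = 1,…,N. Suppose there exists a constant κ > 0 such that μ_i² > 2N L̄² (1 + 1/κ) ‖χ_i‖² Σ_{m=1}^N g_{i,m}² for every i = 1,…,N, and λ_{N+1}² > L̄² (1 + κN)(1 + 2N Σ_{i=1}^N Σ_{m=1}^N ‖χ_i‖² g_{i,m}²).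 Then there exist constants ω₁,…,ω_N > 0, γ > 0, R > 0 and θ > 0 such that for all (w, y) ∈ D × ℝ^N, V̇(w, y, v(w, y)) ≤ −θ(‖w‖² + Σ_{i=1}^N y_i²), where V̇(w, y, v) := R Σ_{n=1}^N ⟨φ_n, w⟩⟨φ_n, ẇ⟩ + Σ_{i=1}^N ω_i y_i v_i − Σ_{i=1}^N μ_i ω_i y_i² + γ ⟨w − Pw, ẇ − Pẇ⟩ with ẇ := −Aw − Σ_{i=1}^N v_i χ_i + F(u). -/
open scoped RealInnerProductSpace

/- Setting: real Hilbert space with orthonormal basis (φ_n)_{n∈ℕ} (0-indexed, so the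
paper's φ_{n+1} is φ n here and the paper's λ_{N+1} is `lam N`). -/

/-- The operator `A` (diagonal w.r.t. the basis `φ` with eigenvalues `lam`). -/
noncomputable def Aop {H : Type*} [NormedAddCommGroup H] [InnerProductSpace ℝ H]
    (φ : ℕ → H) (lam : ℕ → ℝ) (w : H) : H :=
  ∑' n : ℕ, (lam n * ⟪φ n, w⟫) • φ n

/-- The orthogonal projection `P` onto the span of the first `N` basis vectors. -/
noncomputable def Pop {H : Type*} [NormedAddCommGroup H] [InnerProductSpace ℝ H]
    (φ : ℕ → H) (N : ℕ) (w : H) : H :=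
  ∑ n ∈ Finset.range N, ⟪φ n, w⟫ • φ n

/-- The expression (3.17) for the derivative of the CLF `V` along solutions of the
semilinear problem, with `ẇ = -Aw - Σ v_i χ_i + F(u)` and `u = w + Σ y_i χ_i`. -/
noncomputable def VdotNL {H : Type*} [NormedAddCommGroup H] [InnerProductSpace ℝ H]
    (φ : ℕ → H) (lam : ℕ → ℝ) (N : ℕ) (χ : Fin N → H) (μ ω : Fin N → ℝ)
    (γ R : ℝ) (F : H → H) (w : H) (y v : Fin N → ℝ) : ℝ :=
  let u : H := w + ∑ i, y i • χ i
  let wd : H := -Aop φ lam w - ∑ i, v i • χ i + F u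
  R * ∑ n ∈ Finset.range N, ⟪φ n, w⟫ * ⟪φ n, wd⟫
    + ∑ i, ω i * y i * v i - ∑ i, μ i * ω i * y i ^ 2
    + γ * ⟪w - Pop φ N w, wd - Pop φ N wd⟫

section Spectral

variable {H : Type*} [NormedAddCommGroup H] [InnerProductSpace ℝ H]

lemma inner_Pop {φ : ℕ → H} (hon : Orthonormal ℝ φ) (N n : ℕ) (w : H) :
    ⟪φ n, Pop φ N w⟫ = if n < N then ⟪φ n, w⟫ else 0 := by
  simp [Pop, inner_sum, real_inner_smul_right, orthonormal_iff_ite.mp hon]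

lemma inner_sub_Pop {φ : ℕ → H} (hon : Orthonormal ℝ φ) (N n : ℕ) (w : H) :
    ⟪φ n, w - Pop φ N w⟫ = if n < N then 0 else ⟪φ n, w⟫ := by
  rw [inner_sub_right, inner_Pop hon]
  split_ifs <;> simp

lemma inner_sub_Pop_Pop {φ : ℕ → H} (hon : Orthonormal ℝ φ) (N : ℕ) (w x : H) :
    ⟪w - Pop φ N w, Pop φ N x⟫ = 0 := by
  conv_lhs => rw [real_inner_comm]; arg 2; rw [Pop]
  rw [sum_inner]
  refine Finset.sum_eq_zero fun n hn => ?_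
  rw [real_inner_smul_left, inner_sub_Pop hon, if_pos (Finset.mem_range.mp hn), mul_zero]

lemma norm_Pop_sq {φ : ℕ → H} (hon : Orthonormal ℝ φ) (N : ℕ) (w : H) :
    ‖Pop φ N w‖ ^ 2 = ∑ n ∈ Finset.range N, ⟪φ n, w⟫ ^ 2 := by
  rw [← real_inner_self_eq_norm_sq]
  conv_lhs => arg 2; rw [Pop]
  rw [sum_inner]
  refine Finset.sum_congr rfl fun n hn => ?_
  rw [real_inner_smul_left, inner_Pop hon, if_pos (Finset.mem_range.mp hn), sq]

lemma norm_sq_eq_Pop {φ : ℕ → H} (hon : Orthonormal ℝ φ) (N : ℕ) (w : H) :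
    ‖w‖ ^ 2 = ‖Pop φ N w‖ ^ 2 + ‖w - Pop φ N w‖ ^ 2 := by
  have h := norm_add_sq_real (w - Pop φ N w) (Pop φ N w)
  rw [inner_sub_Pop_Pop hon, sub_add_cancel] at h
  linarith

variable [CompleteSpace H]

lemma inner_Aop {φ : ℕ → H} (hon : Orthonormal ℝ φ) {lam : ℕ → ℝ} {w : H}
    (hw : Summable fun n : ℕ => lam n ^ 2 * ⟪φ n, w⟫ ^ 2) (n : ℕ) :
    ⟪φ n, Aop φ lam w⟫ = lam n * ⟪φ n, w⟫ := by
  have hs : Summable fun k => (lam k * ⟪φ k, w⟫) • φ k := by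
    have := (hon.orthogonalFamily.summable_iff_norm_sq_summable
      (fun k => lam k * ⟪φ k, w⟫)).mpr (by simpa [mul_pow] using hw)
    simpa using this
  have h1 := hs.hasSum.mapL (innerSL ℝ (φ n))
  have h2 := hasSum_single (f := fun k => innerSL ℝ (φ n) ((lam k * ⟪φ k, w⟫) • φ k)) n
    (fun k hk => by simp [hon.inner_eq_zero hk.symm])
  have h3 := h1.unique h2
  simpa [Aop, real_inner_smul_right, hon.norm_eq_one] using h3

lemma mul_norm_sq_le_inner_Aop {φ : ℕ → H} (hon : Orthonormal ℝ φ)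
    (htot : ⊤ ≤ (Submodule.span ℝ (Set.range φ)).topologicalClosure)
    {lam : ℕ → ℝ} (hlam : Monotone lam) (N : ℕ) {w : H}
    (hw : Summable fun n : ℕ => lam n ^ 2 * ⟪φ n, w⟫ ^ 2) :
    lam N * ‖w - Pop φ N w‖ ^ 2 ≤ ⟪w - Pop φ N w, Aop φ lam w⟫ := by
  have h1 := (HilbertBasis.mk hon htot).hasSum_inner_mul_inner (w - Pop φ N w) (Aop φ lam w)
  have h2 := ((HilbertBasis.mk hon htot).hasSum_inner_mul_inner (w - Pop φ N w)
    (w - Pop φ N w)).mul_left (lam N)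
  rw [← real_inner_self_eq_norm_sq]
  refine hasSum_le (fun n => ?_) h2 h1
  rw [HilbertBasis.coe_mk, real_inner_comm, inner_Aop hon hw, inner_sub_Pop hon]
  split_ifs with h
  · simp
  · nlinarith [mul_le_mul_of_nonneg_right (hlam (not_lt.mp h)) (sq_nonneg ⟪φ n, w⟫)]

end Spectral

section Estimates

variable {H : Type*} [NormedAddCommGroup H] [InnerProductSpace ℝ H]

lemma norm_sq_sum_smul_of_pairwise_orthogonal {ι : Type*} [Fintype ι] {χ : ι → H}
    (hχ : ∀ i m, i ≠ m → ⟪χ i, χ m⟫ = 0) (y : ι → ℝ) :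
    ‖∑ i, y i • χ i‖ ^ 2 = ∑ i, ‖χ i‖ ^ 2 * y i ^ 2 := by
  rw [← real_inner_self_eq_norm_sq, sum_inner]
  refine Finset.sum_congr rfl fun i _ => ?_
  rw [inner_sum, Finset.sum_eq_single i]
  · rw [real_inner_smul_left, real_inner_smul_right, real_inner_self_eq_norm_sq]; ring
  · intro m _ hm
    rw [real_inner_smul_left, real_inner_smul_right, hχ i m hm.symm]; ring
  · simp

lemma norm_sub_sq_le_of_norm_sq_le {x r : H} {S p : ℝ} (hx : ‖x‖ ^ 2 ≤ S * p ^ 2) (hS : 0 ≤ S) :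
    ‖r - x‖ ^ 2 ≤ (S + 1 / 2) * p ^ 2 + (1 + 2 * S) * ‖r‖ ^ 2 := by
  have h1 : |2 * (‖r‖ * ‖x‖)| ≤ p ^ 2 / 2 + 2 * S * ‖r‖ ^ 2 := by
    refine abs_le_of_sq_le_sq ?_ (by positivity)
    nlinarith [mul_le_mul_of_nonneg_left hx (sq_nonneg ‖r‖),
      sq_nonneg (p ^ 2 / 2 - 2 * S * ‖r‖ ^ 2)]
  have h2 := neg_le_of_abs_le (abs_real_inner_le_norm r x)
  rw [norm_sub_sq_real]
  linarith [le_of_abs_le h1]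

/-- Quadratic absorption of a cross term. -/
lemma absorb_cross_term {m s t C : ℝ} (hm : 0 < m) :
    C * (s * t) ≤ m / 4 * t ^ 2 + C ^ 2 / m * s ^ 2 := by
  have h : m / 4 * t ^ 2 + C ^ 2 / m * s ^ 2 - C * (s * t) = (m * t / 2 - C * s) ^ 2 / m := by
    field_simp
    ring
  have : 0 ≤ (m * t / 2 - C * s) ^ 2 / m := by positivity
  linarith

lemma mul_mul_le_of_pos {μ ω : ℝ} (hμ : 0 < μ) (hω : 0 < ω) (y G : ℝ) :
    ω * y * G ≤ μ * ω * y ^ 2 / 2 + ω / (2 * μ) * G ^ 2 := by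
  have h : μ * ω * y ^ 2 / 2 + ω / (2 * μ) * G ^ 2 - ω * y * G
      = ω / (2 * μ) * (μ * y - G) ^ 2 := by
    field_simp
    ring
  have : 0 ≤ ω / (2 * μ) * (μ * y - G) ^ 2 := by positivity
  linarith

lemma exists_pos_le_forall {ι : Type*} [Finite ι] {a : ℝ} (ha : 0 < a) {f : ι → ℝ}
    (hf : ∀ i, 0 < f i) : ∃ m, 0 < m ∧ m ≤ a ∧ ∀ i, m ≤ f i := by
  cases isEmpty_or_nonempty ι
  · exact ⟨a, ha, le_rfl, fun i => isEmptyElim i⟩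
  · obtain ⟨i₀, h⟩ := Finite.exists_min f
    exact ⟨min a (f i₀), lt_min ha (hf i₀), min_le_left _ _,
      fun i => (min_le_right _ _).trans (h i)⟩

lemma norm_add_add_sq_le {z x Y : H} (hzx : ⟪z, x⟫ = 0) {κ : ℝ} (hκ : 0 < κ) {N : ℕ}
    (hN : 1 ≤ N) :
    ‖z + x + Y‖ ^ 2 ≤ (1 + κ * N) * ‖z‖ ^ 2 + (1 + 1 / κ) * ‖Y‖ ^ 2
      + ‖x‖ ^ 2 + 2 * (‖x‖ * ‖Y‖) := by
  have hN' : (1 : ℝ) ≤ N := by exact_mod_cast hN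
  have h0 : 2 * (‖z‖ * ‖Y‖) ≤ κ * ‖z‖ ^ 2 + 1 / κ * ‖Y‖ ^ 2 := by
    have h : κ * ‖z‖ ^ 2 + 1 / κ * ‖Y‖ ^ 2 - 2 * (‖z‖ * ‖Y‖) = (κ * ‖z‖ - ‖Y‖) ^ 2 / κ := by
      field_simp
      ring
    have : 0 ≤ (κ * ‖z‖ - ‖Y‖) ^ 2 / κ := by positivity
    linarith
  have h1 : κ * ‖z‖ ^ 2 ≤ κ * N * ‖z‖ ^ 2 := by
    have : κ ≤ κ * N := le_mul_of_one_le_right hκ.le hN'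
    gcongr
  rw [norm_add_sq_real, norm_add_sq_real, inner_add_left, hzx]
  linarith [real_inner_le_norm z Y, real_inner_le_norm x Y]

lemma abs_sum_mul_le {ι : Type*} [Fintype ι] {a q : ι → ℝ} {s : ℝ} (hq : ∀ i, |q i| ≤ s) :
    |∑ i, a i * q i| ≤ (∑ i, |a i|) * s := by
  rw [Finset.sum_mul]
  refine (Finset.abs_sum_le_sum_abs _ _).trans (Finset.sum_le_sum fun i _ => ?_)
  rw [abs_mul]
  exact mul_le_mul_of_nonneg_left (hq i) (abs_nonneg _)

lemma norm_sum_smul_le {ι : Type*} [Fintype ι] {c : ι → ℝ} {χ : ι → H} {h : ι → ℝ} {s : ℝ}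
    (hc : ∀ i, |c i| ≤ h i * s) : ‖∑ i, c i • χ i‖ ≤ (∑ i, h i * ‖χ i‖) * s := by
  rw [Finset.sum_mul]
  refine (norm_sum_le _ _).trans (Finset.sum_le_sum fun i _ => ?_)
  rw [norm_smul, Real.norm_eq_abs]
  nlinarith [mul_le_mul_of_nonneg_right (hc i) (norm_nonneg (χ i))]

lemma sum_sq_pos_of_mul_eq_neg_one {ι : Type*} [Fintype ι] [DecidableEq ι]
    {g B : Matrix ι ι ℝ} (h : g * B = -1) (i : ι) : 0 < ∑ m, g i m ^ 2 := by
  by_contra! hle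
  have h0 := (Finset.sum_eq_zero_iff_of_nonneg (fun m _ => sq_nonneg (g i m))).mp
    (le_antisymm hle (Finset.sum_nonneg fun m _ => sq_nonneg (g i m)))
  have h1 := congrFun (congrFun h i) i
  rw [Matrix.mul_apply, Finset.sum_eq_zero fun m hm => by
    rw [pow_eq_zero_iff two_ne_zero |>.mp (h0 m hm), zero_mul]] at h1
  simp at h1

lemma inner_sum_feedback {ι : Type*} [Fintype ι] [DecidableEq ι] {χ e : ι → H}
    {g B : Matrix ι ι ℝ} (hB : ∀ n i, B n i = -⟪χ i, e n⟫) (hBg : B * g = -1)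
    (x : ι → ℝ) (n : ι) : ⟪e n, ∑ i, (∑ m, g i m * x m) • χ i⟫ = x n := by
  have h := congrFun (Matrix.mulVec_mulVec x B g) n
  rw [hBg, Matrix.neg_mulVec, Matrix.one_mulVec] at h
  simp only [Matrix.mulVec, dotProduct, hB, Pi.neg_apply, neg_mul, Finset.sum_neg_distrib,
    neg_inj] at h
  rw [inner_sum, ← h]
  refine Finset.sum_congr rfl fun i _ => ?_
  rw [real_inner_smul_right, real_inner_comm, mul_comm]

end Estimates

/- STATEMENT 13 (Theorem 3.1, dissipation inequality for the nonlinear controller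
(3.9), spectral form). -/

set_option maxHeartbeats 1600000 in
theorem stmt_13 {H : Type*} [NormedAddCommGroup H] [InnerProductSpace ℝ H] [CompleteSpace H]
    (φ : ℕ → H) (hon : Orthonormal ℝ φ)
    (htot : ⊤ ≤ (Submodule.span ℝ (Set.range φ)).topologicalClosure)
    (lam : ℕ → ℝ) (hlam : StrictMono lam)
    (N : ℕ) (hN : 1 ≤ N) (hpos : 0 < lam N)
    (χ : Fin N → H) (hχ : ∀ i m : Fin N, i ≠ m → ⟪χ i, χ m⟫ = 0)
    (μ : Fin N → ℝ) (hμ : ∀ i, 0 < μ i)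
    (B : Matrix (Fin N) (Fin N) ℝ)
    (hB : ∀ (n i : Fin N), B n i = -⟪χ i, φ (n : ℕ)⟫)
    (hBunit : IsUnit B)
    (g : Matrix (Fin N) (Fin N) ℝ) (hg : g = -B⁻¹)
    (F : H → H) (hFcont : Continuous F) (hF0 : F 0 = 0)
    (Lbar : ℝ) (hLbar : 0 ≤ Lbar) (hFgrowth : ∀ u : H, ‖F u‖ ≤ Lbar * ‖u‖)
    (σ : ℝ) (hσ : 0 < σ)
    (κ : ℝ) (hκ : 0 < κ)
    (hcond1 : ∀ i, μ i ^ 2 > 2 * N * Lbar ^ 2 * (1 + 1 / κ) * ‖χ i‖ ^ 2 * ∑ m, g i m ^ 2)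
    (hcond2 : lam N ^ 2
      > Lbar ^ 2 * (1 + κ * N) * (1 + 2 * N * ∑ i, ∑ m, ‖χ i‖ ^ 2 * g i m ^ 2)) :
    ∃ (ω : Fin N → ℝ) (γ R θ : ℝ),
      (∀ i, 0 < ω i) ∧ 0 < γ ∧ 0 < R ∧ 0 < θ ∧
      ∀ w : H, (Summable fun n : ℕ => lam n ^ 2 * ⟪φ n, w⟫ ^ 2) →
        ∀ y : Fin N → ℝ,
          VdotNL φ lam N χ μ ω γ R F w y
            (fun i =>
              (∑ m : Fin N, g i m * (σ - lam (m : ℕ)) * ⟪φ (m : ℕ), w⟫)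
                + ∑ m : Fin N, g i m * ⟪φ (m : ℕ), F (w + ∑ l, y l • χ l)⟫)
          ≤ -θ * (‖w‖ ^ 2 + ∑ i, y i ^ 2) := by

  have hBdet : IsUnit B.det := (Matrix.isUnit_iff_isUnit_det B).mp hBunit
  have hBg : B * g = -1 := by rw [hg, mul_neg, Matrix.mul_nonsing_inv B hBdet]
  have hgB : g * B = -1 := by rw [hg, neg_mul, Matrix.nonsing_inv_mul B hBdet]
  have hN' : (1 : ℝ) ≤ N := by exact_mod_cast hN
  set Γ : Fin N → ℝ := fun i => ∑ m, g i m ^ 2 with hΓ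
  have hΓpos : ∀ i, 0 < Γ i := sum_sq_pos_of_mul_eq_neg_one hgB
  set S : ℝ := ∑ i, ‖χ i‖ ^ 2 * Γ i with hS
  have hS0 : 0 ≤ S := Finset.sum_nonneg fun i _ => mul_nonneg (sq_nonneg _) (hΓpos i).le
  set M : ℝ := 1 + 2 * N * S with hM
  have hM0 : 0 < M := by positivity
  have hcond2' : 0 < lam N ^ 2 - Lbar ^ 2 * (1 + κ * N) * M := by
    simp_rw [← Finset.mul_sum] at hcond2
    exact sub_pos.mpr hcond2
  set ω : Fin N → ℝ := fun i => M * μ i / (2 * N * Γ i) with hω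
  have hωpos : ∀ i, 0 < ω i := fun i => by
    have := hΓpos i
    have := hμ i
    positivity
  have hcond1' : ∀ i, 0 < μ i * ω i - Lbar ^ 2 * (1 + 1 / κ) * ‖χ i‖ ^ 2 * M := fun i => by
    have h1 := hΓpos i
    have h2 : μ i * ω i = M * μ i ^ 2 / (2 * N * Γ i) := by simp only [hω]; ring
    rw [h2, sub_pos, lt_div_iff₀ (by positivity)]
    calc Lbar ^ 2 * (1 + 1 / κ) * ‖χ i‖ ^ 2 * M * (2 * N * Γ i)
        = M * (2 * N * Lbar ^ 2 * (1 + 1 / κ) * ‖χ i‖ ^ 2 * Γ i) := by ring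
      _ < M * μ i ^ 2 := mul_lt_mul_of_pos_left (hcond1 i) hM0
  obtain ⟨m, hm, hmz, hmy⟩ := exists_pos_le_forall hcond2' hcond1'
  set h : Fin N → ℝ := fun i => ∑ k : Fin N, |g i k * (σ - lam k)| with hh
  have hh0 : ∀ i, 0 ≤ h i := fun i => Finset.sum_nonneg fun k _ => abs_nonneg _
  set C : ℝ := ∑ i, ω i * h i + lam N * (∑ i, h i * ‖χ i‖) + M * Lbar ^ 2 * ∑ i, ‖χ i‖ with hC
  refine ⟨ω, lam N, (m / 4 + C ^ 2 / m + M * Lbar ^ 2 / 2) / σ, m / 4, hωpos, hpos,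
    by positivity, by positivity, fun w hw y => ?_⟩
  set Y : H := ∑ l, y l • χ l with hY
  set f : H := F (w + Y) with hf
  set z : H := w - Pop φ N w with hz
  set r : H := f - Pop φ N f with hr
  set q : Fin N → ℝ := fun i => ∑ k : Fin N, g i k * (σ - lam k) * ⟪φ k, w⟫ with hq
  set G : Fin N → ℝ := fun i => ∑ k : Fin N, g i k * ⟪φ k, f⟫ with hG
  set s : ℝ := ‖Pop φ N w‖ with hs
  set p : ℝ := ‖Pop φ N f‖ with hp
  set t : ℝ := √(‖z‖ ^ 2 + ∑ i, y i ^ 2) with ht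
  have hs0 : 0 ≤ s := norm_nonneg _
  have ht0 : 0 ≤ t := Real.sqrt_nonneg _
  have hysum : 0 ≤ ∑ i, y i ^ 2 := Finset.sum_nonneg fun i _ => sq_nonneg _
  have ht2 : t ^ 2 = ‖z‖ ^ 2 + ∑ i, y i ^ 2 := Real.sq_sqrt (by positivity)
  have hzt : ‖z‖ ≤ t := Real.le_sqrt_of_sq_le (by linarith)
  have hyt : ∀ i, |y i| ≤ t := fun i => Real.abs_le_sqrt (by
    have := Finset.single_le_sum (f := fun i => y i ^ 2) (fun i _ => sq_nonneg _)
      (Finset.mem_univ i)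
    nlinarith [sq_nonneg ‖z‖])
  -- bounds on the two parts of the control
  have hqs : ∀ i, |q i| ≤ h i * s := fun i => abs_sum_mul_le fun k => by
    rw [← Real.sqrt_sq hs0]
    refine Real.abs_le_sqrt ?_
    rw [norm_Pop_sq hon]
    exact Finset.single_le_sum (f := fun n => ⟪φ n, w⟫ ^ 2) (fun n _ => sq_nonneg _)
      (Finset.mem_range.mpr k.2)
  have hGp : ∀ i, G i ^ 2 ≤ Γ i * p ^ 2 := fun i => by
    rw [norm_Pop_sq hon, ← Fin.sum_univ_eq_sum_range (fun n => ⟪φ n, f⟫ ^ 2)]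
    exact Finset.sum_mul_sq_le_sq_mul_sq _ _ _
  -- the low modes decay at rate `σ`
  have hwd : ∀ n ∈ Finset.range N,
      ⟪φ n, w⟫ * ⟪φ n, -Aop φ lam w - ∑ i, (q i + G i) • χ i + f⟫ = -σ * ⟪φ n, w⟫ ^ 2 := by
    intro n hn
    have h1 := inner_sum_feedback (e := fun k : Fin N => φ k) hB hBg
      (fun k => (σ - lam k) * ⟪φ k, w⟫ + ⟪φ k, f⟫) ⟨n, Finset.mem_range.mp hn⟩
    have h2 : ∀ i, ∑ k : Fin N, g i k * ((σ - lam k) * ⟪φ k, w⟫ + ⟪φ k, f⟫) = q i + G i :=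
      fun i => by
        rw [← Finset.sum_add_distrib]
        exact Finset.sum_congr rfl fun k _ => by ring
    simp_rw [h2] at h1
    rw [inner_add_right, inner_sub_right, inner_neg_right, inner_Aop hon hw, h1]
    ring
  have hlow : ∑ n ∈ Finset.range N,
      ⟪φ n, w⟫ * ⟪φ n, -Aop φ lam w - ∑ i, (q i + G i) • χ i + f⟫ = -σ * s ^ 2 := by
    rw [Finset.sum_congr rfl hwd, ← Finset.mul_sum, norm_Pop_sq hon]
  -- the high modes
  have hhigh : ∀ x, ⟪z, x - Pop φ N x⟫ = ⟪z, x⟫ := fun x => by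
    rw [inner_sub_right, inner_sub_Pop_Pop hon, sub_zero]
  have hsplit : ⟪z, -Aop φ lam w - ∑ i, (q i + G i) • χ i + f⟫
      = -⟪z, Aop φ lam w⟫ - ⟪z, ∑ i, q i • χ i⟫ + ⟪z, r - ∑ i, G i • χ i⟫ := by
    simp_rw [add_smul]
    rw [Finset.sum_add_distrib, inner_add_right, inner_sub_right, inner_neg_right,
      inner_add_right, inner_sub_right z r, hr, hhigh]
    ring
  have hA := mul_norm_sq_le_inner_Aop hon htot hlam.monotone N hw
  have hzq : -⟪z, ∑ i, q i • χ i⟫ ≤ (∑ i, h i * ‖χ i‖) * (s * t) := by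
    have h0 := neg_le_of_abs_le (abs_real_inner_le_norm z (∑ i, q i • χ i))
    have h1 := mul_le_mul hzt (norm_sum_smul_le (χ := χ) hqs) (norm_nonneg _) ht0
    linarith
  have hX : ‖r - ∑ i, G i • χ i‖ ^ 2 ≤ (S + 1 / 2) * p ^ 2 + (1 + 2 * S) * ‖r‖ ^ 2 := by
    refine norm_sub_sq_le_of_norm_sq_le ?_ hS0
    rw [norm_sq_sum_smul_of_pairwise_orthogonal hχ, hS, Finset.sum_mul]
    refine Finset.sum_le_sum fun i _ => ?_
    rw [mul_assoc]
    exact mul_le_mul_of_nonneg_left (hGp i) (sq_nonneg _)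
  have hzX : lam N * ⟪z, r - ∑ i, G i • χ i⟫
      ≤ lam N ^ 2 * ‖z‖ ^ 2 / 2 + ‖r - ∑ i, G i • χ i‖ ^ 2 / 2 := by
    have h1 := mul_le_mul_of_nonneg_left (real_inner_le_norm z (r - ∑ i, G i • χ i)) hpos.le
    nlinarith [sq_nonneg (lam N * ‖z‖ - ‖r - ∑ i, G i • χ i‖)]
  -- the actuator states
  have hyq : ∑ i, ω i * y i * q i ≤ (∑ i, ω i * h i) * (s * t) := by
    rw [Finset.sum_mul]
    refine Finset.sum_le_sum fun i _ => ?_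
    have h1 : y i * q i ≤ t * (h i * s) := by
      refine (le_abs_self _).trans ?_
      rw [abs_mul]
      exact mul_le_mul (hyt i) (hqs i) (abs_nonneg _) ht0
    nlinarith [mul_le_mul_of_nonneg_left h1 (hωpos i).le]
  have hyG : ∑ i, ω i * y i * G i ≤ (∑ i, μ i * ω i * y i ^ 2) / 2 + M / 4 * p ^ 2 := by
    have h1 : M / 4 * p ^ 2 = ∑ _i : Fin N, M / (4 * N) * p ^ 2 := by
      rw [Finset.sum_const, Finset.card_univ, Fintype.card_fin, nsmul_eq_mul]
      field_simp
    rw [h1, Finset.sum_div, ← Finset.sum_add_distrib]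
    refine Finset.sum_le_sum fun i _ => ?_
    have hμi := hμ i
    have hΓi := hΓpos i
    have hωi := hωpos i
    have h2 := mul_mul_le_of_pos hμi hωi (y i) (G i)
    have h3 : ω i / (2 * μ i) * G i ^ 2 ≤ ω i / (2 * μ i) * (Γ i * p ^ 2) :=
      mul_le_mul_of_nonneg_left (hGp i) (by positivity)
    have h4 : ω i / (2 * μ i) * (Γ i * p ^ 2) = M / (4 * N) * p ^ 2 := by
      simp only [hω]
      field_simp
      ring
    linarith
  -- growth of the nonlinearity
  have hYsq := norm_sq_sum_smul_of_pairwise_orthogonal hχ y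
  have hYt : ‖Y‖ ≤ (∑ i, ‖χ i‖) * t := by
    have := norm_sum_smul_le (c := y) (χ := χ) (h := fun _ => (1 : ℝ)) (s := t)
      (fun i => by simpa using hyt i)
    simpa using this
  have hu := norm_add_add_sq_le (inner_sub_Pop_Pop hon N w w) (Y := Y) hκ hN
  rw [sub_add_cancel, hYsq] at hu
  have hfu : ‖f‖ ^ 2 ≤ Lbar ^ 2 * ‖w + Y‖ ^ 2 := by
    rw [← mul_pow]
    exact pow_le_pow_left₀ (norm_nonneg _) (hFgrowth _) 2
  have hfpr : p ^ 2 + ‖r‖ ^ 2 = ‖f‖ ^ 2 := (norm_sq_eq_Pop hon N f).symm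
  have hcoef : M / 4 * p ^ 2 + ((S + 1 / 2) * p ^ 2 + (1 + 2 * S) * ‖r‖ ^ 2) / 2
      ≤ M / 2 * ‖f‖ ^ 2 := by
    have h1 : S ≤ N * S := le_mul_of_one_le_left hS0 hN'
    rw [← hfpr]
    nlinarith [mul_le_mul_of_nonneg_right h1 (sq_nonneg p),
      mul_le_mul_of_nonneg_right h1 (sq_nonneg ‖r‖)]
  have hfinal : M / 2 * ‖f‖ ^ 2 ≤ M * Lbar ^ 2 / 2 * ((1 + κ * N) * ‖z‖ ^ 2
      + (1 + 1 / κ) * ∑ i, ‖χ i‖ ^ 2 * y i ^ 2 + s ^ 2)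
      + M * Lbar ^ 2 * (∑ i, ‖χ i‖) * (s * t) := by
    have h1 : s * ‖Y‖ ≤ s * ((∑ i, ‖χ i‖) * t) := mul_le_mul_of_nonneg_left hYt hs0
    have h2 : ‖w + Y‖ ^ 2 ≤ (1 + κ * N) * ‖z‖ ^ 2
      + (1 + 1 / κ) * ∑ i, ‖χ i‖ ^ 2 * y i ^ 2 + s ^ 2 + 2 * (s * ((∑ i, ‖χ i‖) * t)) := by
      linarith
    have h3 := hfu.trans (mul_le_mul_of_nonneg_left h2 (sq_nonneg Lbar))
    have h4 := mul_le_mul_of_nonneg_left h3 (by positivity : 0 ≤ M / 2)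
    linarith
  have hmysum : m * ∑ i, y i ^ 2 ≤ ∑ i, μ i * ω i * y i ^ 2
      - Lbar ^ 2 * (1 + 1 / κ) * M * ∑ i, ‖χ i‖ ^ 2 * y i ^ 2 := by
    rw [Finset.mul_sum, Finset.mul_sum, ← Finset.sum_sub_distrib]
    refine Finset.sum_le_sum fun i _ => ?_
    linarith [mul_le_mul_of_nonneg_right (hmy i) (sq_nonneg (y i))]
  have hmzsq := mul_le_mul_of_nonneg_right hmz (sq_nonneg ‖z‖)
  have habs := absorb_cross_term (s := s) (t := t) (C := C) hm
  have hAl := mul_le_mul_of_nonneg_left hA hpos.le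
  have hzql := mul_le_mul_of_nonneg_left hzq hpos.le
  have hwsq : ‖w‖ ^ 2 = s ^ 2 + ‖z‖ ^ 2 := norm_sq_eq_Pop hon N w
  have hsum : ∑ i, ω i * y i * (q i + G i) = ∑ i, ω i * y i * q i + ∑ i, ω i * y i * G i := by
    simp_rw [mul_add]
    exact Finset.sum_add_distrib
  have hR : (m / 4 + C ^ 2 / m + M * Lbar ^ 2 / 2) / σ * (-σ * s ^ 2)
      = -(m / 4 + C ^ 2 / m + M * Lbar ^ 2 / 2) * s ^ 2 := by
    field_simp
  have hCst : C * (s * t) = (∑ i, ω i * h i) * (s * t)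
      + lam N * ((∑ i, h i * ‖χ i‖) * (s * t)) + M * Lbar ^ 2 * (∑ i, ‖χ i‖) * (s * t) := by
    rw [hC]
    ring
  change (m / 4 + C ^ 2 / m + M * Lbar ^ 2 / 2) / σ * ∑ n ∈ Finset.range N,
      ⟪φ n, w⟫ * ⟪φ n, -Aop φ lam w - ∑ i, (q i + G i) • χ i + f⟫
    + ∑ i, ω i * y i * (q i + G i) - ∑ i, μ i * ω i * y i ^ 2
    + lam N * ⟪z, (-Aop φ lam w - ∑ i, (q i + G i) • χ i + f)
      - Pop φ N (-Aop φ lam w - ∑ i, (q i + G i) • χ i + f)⟫ ≤ _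
  rw [hlow, hhigh, hsplit, hsum, hR, hwsq]
  rw [ht2] at habs
  linarith
end
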